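/- arXiv:1004.0434 — 6 statements merged into one kernel-verified Lean document; each statement's English description precedes it below -/
import Mathlib

section
/- Let N ≥ 1 and let ρ be a 2N×2N complex matrix which is classical-quantum, i.e. there exist an orthonormal basis {f₁, f₂} of ℂ² and positive semidefinite N×N complex matrices σ₁, σ₂ such that ρ = |f₁⟩⟨f₁| ⊗ σ₁ + |f₂⟩⟨f₂| ⊗ σ₂ (Kronecker products). Then ρ is SPPT: there exist N×N complex matrices X₁, X₂, S with S normal (S†S = SS†) such that ρ = X†X, where X is the 2×2 block matrix X = fromBlocks X₁ (S·X₁) 0 X₂. -/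
open Matrix ComplexOrder

/-- The rank-one projector `|f⟩⟨f|` onto a vector `f ∈ ℂ²`. -/
noncomputable def proj2 (f : Fin 2 → ℂ) : Matrix (Fin 2) (Fin 2) ℂ :=
  vecMulVec f (star f)

/-- The Kronecker product of a `2 × 2` matrix with an `N × N` matrix,
written as a `2 × 2` block matrix with `N × N` blocks. -/
noncomputable def kron2 {N : ℕ} (A : Matrix (Fin 2) (Fin 2) ℂ)
    (B : Matrix (Fin N) (Fin N) ℂ) : Matrix (Fin N ⊕ Fin N) (Fin N ⊕ Fin N) ℂ :=
  fromBlocks (A 0 0 • B) (A 0 1 • B) (A 1 0 • B) (A 1 1 • B)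

theorem aux_factor {N : ℕ} (A : Matrix (Fin N) (Fin N) ℂ) (hA : A.PosSemidef) :
    ∃ T G : Matrix (Fin N) (Fin N) ℂ, Tᴴ * T = A ∧ A * G * T = A ∧ (1 - Gᴴ * A * G).PosSemidef := by
  set U : Matrix (Fin N) (Fin N) ℂ := (hA.1.eigenvectorUnitary).1 with hU
  have hUU : Uᴴ * U = 1 := by
    have := Unitary.coe_star_mul_self hA.1.eigenvectorUnitary
    simpa [star_eq_conjTranspose] using this
  set l := hA.1.eigenvalues with hl
  have hl0 : ∀ i, 0 ≤ l i := hA.eigenvalues_nonneg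
  set D : Matrix (Fin N) (Fin N) ℂ := diagonal (fun i => (l i : ℂ)) with hD
  set E : Matrix (Fin N) (Fin N) ℂ := diagonal (fun i => (Real.sqrt (l i) : ℂ)) with hE
  set F : Matrix (Fin N) (Fin N) ℂ := diagonal (fun i => (((Real.sqrt (l i))⁻¹ : ℝ) : ℂ)) with hF
  have hAs : A = U * D * Uᴴ := by
    have := hA.1.spectral_theorem
    simpa [Unitary.conjStarAlgAut_apply, star_eq_conjTranspose, Function.comp_def] using this
  have hEH : Eᴴ = E := by
    rw [hE, diagonal_conjTranspose]; congr 1; ext i; simp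
  have hFH : Fᴴ = F := by
    rw [hF, diagonal_conjTranspose]; congr 1; ext i; simp
  have hEE : E * E = D := by
    rw [hE, hD, diagonal_mul_diagonal]; congr 1; ext i
    rw [← Complex.ofReal_mul, Real.mul_self_sqrt (hl0 i)]
  have hDFE : D * F * E = D := by
    rw [hE, hD, hF, diagonal_mul_diagonal, diagonal_mul_diagonal]; congr 1; ext i
    rw [← Complex.ofReal_mul, ← Complex.ofReal_mul]
    congr 1
    by_cases h : Real.sqrt (l i) = 0
    · have := (Real.sqrt_eq_zero (hl0 i)).1 h
      simp [this]
    · field_simp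
  have hFDF : (1 - F * D * F).PosSemidef := by
    rw [hD, hF, diagonal_mul_diagonal, diagonal_mul_diagonal, ← diagonal_one, diagonal_sub]
    refine PosSemidef.diagonal ?_
    intro i
    simp only [Pi.zero_apply]
    rw [← Complex.ofReal_mul, ← Complex.ofReal_mul, ← Complex.ofReal_one, ← Complex.ofReal_sub]
    rw [Complex.zero_le_real]
    by_cases h : Real.sqrt (l i) = 0
    · simp [h]
    · have h2 : l i = Real.sqrt (l i) * Real.sqrt (l i) := (Real.mul_self_sqrt (hl0 i)).symm
      have : (√(l i))⁻¹ * l i * (√(l i))⁻¹ = 1 := by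
        nth_rewrite 2 [h2]
        field_simp
      rw [this]; simp
  refine ⟨E * Uᴴ, U * F, ?_, ?_, ?_⟩
  · rw [conjTranspose_mul, hEH, conjTranspose_conjTranspose, hAs, ← hEE]
    simp only [Matrix.mul_assoc]
  · have : U * D * Uᴴ * (U * F) * (E * Uᴴ) = U * (D * (Uᴴ * U) * F * E) * Uᴴ := by
      simp only [Matrix.mul_assoc]
    rw [hAs, this, hUU, Matrix.mul_one, hDFE]
  · have : (U * F)ᴴ * (U * D * Uᴴ) * (U * F) = F * (Uᴴ * U) * D * (Uᴴ * U) * F := by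
      rw [conjTranspose_mul, hFH]; simp only [Matrix.mul_assoc]
    rw [hAs, this, hUU, Matrix.mul_one, Matrix.mul_one]
    exact hFDF

theorem aux_exists {N : ℕ} {A : Matrix (Fin N) (Fin N) ℂ} (hA : A.PosSemidef) :
    ∃ X : Matrix (Fin N) (Fin N) ℂ, A = Xᴴ * X := by
  obtain ⟨T, _, h, _⟩ := aux_factor A hA
  exact ⟨T, h.symm⟩

open scoped MatrixOrder in
theorem aux_ker {N : ℕ} (A B Z : Matrix (Fin N) (Fin N) ℂ) (hA : A.PosSemidef)
    (hB : B.PosSemidef) (h : (A + B) * Z = 0) : A * Z = 0 := by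
  obtain ⟨Y, rfl⟩ := aux_exists hA
  obtain ⟨W, rfl⟩ := aux_exists hB
  have h1 : (Y * Z)ᴴ * (Y * Z) + (W * Z)ᴴ * (W * Z) = 0 := by
    have : Zᴴ * ((Yᴴ * Y + Wᴴ * W) * Z) = 0 := by rw [h, Matrix.mul_zero]
    rw [← this]
    simp only [conjTranspose_mul, Matrix.mul_assoc, Matrix.add_mul, Matrix.mul_add]
  have h2 : (Y * Z)ᴴ * (Y * Z) = 0 := by
    have a1 : 0 ≤ (Y * Z)ᴴ * (Y * Z) := (posSemidef_conjTranspose_mul_self (Y * Z)).nonneg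
    have a2 : 0 ≤ (W * Z)ᴴ * (W * Z) := (posSemidef_conjTranspose_mul_self (W * Z)).nonneg
    exact ((add_eq_zero_iff_of_nonneg a1 a2).1 h1).1
  rw [conjTranspose_mul_self_eq_zero] at h2
  rw [Matrix.mul_assoc, h2, Matrix.mul_zero]

theorem aux_K {N : ℕ} (A B : Matrix (Fin N) (Fin N) ℂ) (hA : A.PosSemidef)
    (hB : B.PosSemidef) : ∃ T M : Matrix (Fin N) (Fin N) ℂ, M.PosSemidef ∧ (1 - M).PosSemidef ∧
      A = Tᴴ * M * T ∧ B = Tᴴ * (1 - M) * T := by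
  obtain ⟨T, G, h1, h2, h3⟩ := aux_factor (A + B) (hA.add hB)
  have h4 : A * (1 - G * T) = 0 := by
    apply aux_ker A B _ hA hB
    rw [Matrix.mul_sub, Matrix.mul_one, ← Matrix.mul_assoc, h2, sub_self]
  have h5 : A * (G * T) = A := by
    rw [Matrix.mul_sub, Matrix.mul_one, sub_eq_zero] at h4; exact h4.symm
  have h6 : (G * T)ᴴ * A = A := by
    have := congrArg conjTranspose h5
    rwa [conjTranspose_mul, hA.1.eq] at this
  have h7 : A = Tᴴ * (Gᴴ * A * G) * T := by
    calc A = (G * T)ᴴ * (A * (G * T)) := by rw [h5, h6]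
      _ = _ := by simp only [conjTranspose_mul, Matrix.mul_assoc]
  refine ⟨T, Gᴴ * A * G, hA.conjTranspose_mul_mul_same G, ?_, h7, ?_⟩
  · have : 1 - Gᴴ * A * G = (1 - Gᴴ * (A + B) * G) + Gᴴ * B * G := by noncomm_ring
    rw [this]
    exact h3.add (hB.conjTranspose_mul_mul_same G)
  · rw [Matrix.mul_sub, Matrix.sub_mul, ← h7, Matrix.mul_one, h1]; simp

theorem aux_main {N : ℕ} (p q s : ℂ) (hp : 0 ≤ p) (hq : 0 ≤ q) (hpq : p + q = 1)
    (hs : star s * s = p * q)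
    (σ₁ σ₂ : Matrix (Fin N) (Fin N) ℂ)
    (hσ₁ : σ₁.PosSemidef) (hσ₂ : σ₂.PosSemidef) :
    ∃ X₁ X₂ S : Matrix (Fin N) (Fin N) ℂ,
      Sᴴ * S = S * Sᴴ ∧
      fromBlocks (p • σ₁ + q • σ₂) (s • σ₁ - s • σ₂) (star s • σ₁ - star s • σ₂) (q • σ₁ + p • σ₂)
       = (fromBlocks X₁ (S * X₁) 0 X₂)ᴴ * fromBlocks X₁ (S * X₁) 0 X₂ := by
  by_cases h0 : s = 0
  · obtain ⟨X, hX⟩ := aux_exists ((hσ₁.smul hp).add (hσ₂.smul hq))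
    obtain ⟨Y, hY⟩ := aux_exists ((hσ₁.smul hq).add (hσ₂.smul hp))
    refine ⟨X, Y, 0, by simp, ?_⟩
    rw [hX, hY, h0, fromBlocks_conjTranspose, fromBlocks_multiply]
    simp
  have hpq0 : p * q ≠ 0 := by
    rw [← hs]; exact mul_ne_zero (star_ne_zero.2 h0) h0
  have hp0 : p ≠ 0 := left_ne_zero_of_mul hpq0
  have hq0 : q ≠ 0 := right_ne_zero_of_mul hpq0
  obtain ⟨T, M, hM, hM', h1, h2⟩ := aux_K _ _ (hσ₁.smul hp) (hσ₂.smul hq)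
  have hMM : (M - M * M).PosSemidef := by
    have : M - M * M = Mᴴ * (1 - M) * M + (1 - M)ᴴ * M * (1 - M) := by
      rw [hM.1.eq, hM'.1.eq]; noncomm_ring
    rw [this]
    exact (hM'.conjTranspose_mul_mul_same M).add (hM.conjTranspose_mul_mul_same _)
  obtain ⟨Y, hY⟩ := aux_exists hMM
  have hi : 0 ≤ (p * q)⁻¹ := inv_nonneg.2 (mul_nonneg hp hq)
  obtain ⟨X, hX⟩ := aux_exists ((hMM.conjTranspose_mul_mul_same T).smul hi)
  have e1 : σ₁ = p⁻¹ • (Tᴴ * M * T) := by rw [← h1, smul_smul, inv_mul_cancel₀ hp0, one_smul]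
  have e2 : σ₂ = q⁻¹ • (Tᴴ * (1 - M) * T) := by rw [← h2, smul_smul, inv_mul_cancel₀ hq0, one_smul]
  have hq1 : q = 1 - p := by rw [← hpq]; ring
  -- S = s (M/p - (1-M)/q) = s/(pq) (M - p)
  have hKH : (M - p • (1 : Matrix (Fin N) (Fin N) ℂ))ᴴ = M - p • 1 := by
    rw [conjTranspose_sub, hM.1.eq, conjTranspose_smul, conjTranspose_one,
      (IsSelfAdjoint.of_nonneg hp).star_eq]
  have hr : star (p * q)⁻¹ = (p * q)⁻¹ := (IsSelfAdjoint.of_nonneg hi).star_eq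
  have hSH : ((s * (p * q)⁻¹) • (M - p • (1 : Matrix (Fin N) (Fin N) ℂ)))ᴴ
      = (star s * (p * q)⁻¹) • (M - p • 1) := by
    rw [conjTranspose_smul, hKH, star_mul, hr, mul_comm]
  have hσ : σ₁ - σ₂ = (p * q)⁻¹ • (Tᴴ * (M - p • 1) * T) := by
    rw [e1, e2]
    simp only [Matrix.mul_sub, Matrix.sub_mul, Matrix.mul_one, mul_smul_comm, smul_mul_assoc]
    match_scalars <;> field_simp <;> linear_combination hpq
  refine ⟨T, X, (s * (p * q)⁻¹) • (M - p • 1), ?_, ?_⟩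
  · rw [hSH]; simp only [smul_mul_smul_comm]; congr 1; ring
  · rw [fromBlocks_conjTranspose, fromBlocks_multiply, conjTranspose_mul, hSH, ← hX, ← smul_sub,
      ← smul_sub, hσ, h1, h2, e1, e2]
    congr 1
    · simp [Matrix.mul_sub, Matrix.sub_mul]
    · simp [Matrix.mul_assoc, smul_smul]
    · simp [Matrix.mul_assoc, smul_smul]
    · have h3 : s * star s = p * q := by rw [mul_comm, hs]
      have : Tᴴ * (star s * (p * q)⁻¹) • (M - p • 1) * ((s * (p * q)⁻¹) • (M - p • 1) * T)
        = (p * q)⁻¹ • (Tᴴ * (M - p • 1) * (M - p • 1) * T) := by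
        simp only [mul_smul_comm, smul_mul_assoc, smul_smul, Matrix.mul_assoc]
        congr 1
        calc _ = (s * star s) * (p * q)⁻¹ * (p * q)⁻¹ := by ring
          _ = _ := by rw [h3]; field_simp
      rw [this]
      simp only [Matrix.mul_sub, Matrix.sub_mul, Matrix.mul_one, mul_smul_comm, smul_mul_assoc, Matrix.mul_assoc]
      match_scalars <;> field_simp <;> rw [hq1] <;> ring

/-- Every classical–quantum `2 × N` state is SPPT. -/
theorem classicalQuantum_isSPPT {N : ℕ} (hN : 1 ≤ N)
    (f₁ f₂ : Fin 2 → ℂ)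
    (hf₁ : star f₁ ⬝ᵥ f₁ = 1) (hf₂ : star f₂ ⬝ᵥ f₂ = 1) (hf₁₂ : star f₁ ⬝ᵥ f₂ = 0)
    (σ₁ σ₂ : Matrix (Fin N) (Fin N) ℂ)
    (hσ₁ : σ₁.PosSemidef) (hσ₂ : σ₂.PosSemidef)
    (ρ : Matrix (Fin N ⊕ Fin N) (Fin N ⊕ Fin N) ℂ)
    (hρ : ρ = kron2 (proj2 f₁) σ₁ + kron2 (proj2 f₂) σ₂) :
    ∃ X₁ X₂ S : Matrix (Fin N) (Fin N) ℂ,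
      Sᴴ * S = S * Sᴴ ∧
      ρ = (fromBlocks X₁ (S * X₁) 0 X₂)ᴴ * fromBlocks X₁ (S * X₁) 0 X₂ := by
  obtain ⟨a, b, rfl⟩ : ∃ a b, f₁ = ![a, b] := ⟨f₁ 0, f₁ 1, by ext i; fin_cases i <;> rfl⟩
  obtain ⟨c, d, rfl⟩ : ∃ c d, f₂ = ![c, d] := ⟨f₂ 0, f₂ 1, by ext i; fin_cases i <;> rfl⟩
  simp [dotProduct, Fin.sum_univ_two] at hf₁ hf₂ hf₁₂
  have hf₂₁ : star c * a + star d * b = 0 := by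
    have := congrArg star hf₁₂
    simpa [mul_comm] using this
  have hU : !![star a, star b; star c, star d] * !![a, c; b, d] = 1 := by
    ext i j
    fin_cases i <;> fin_cases j <;> simp [Matrix.mul_apply, Fin.sum_univ_two]
    · exact hf₁
    · exact hf₁₂
    · exact hf₂₁
    · exact hf₂
  have hU' := mul_eq_one_comm.1 hU
  have u00 := congrFun (congrFun hU' 0) 0
  have u01 := congrFun (congrFun hU' 0) 1
  have u10 := congrFun (congrFun hU' 1) 0
  have u11 := congrFun (congrFun hU' 1) 1
  simp [Matrix.mul_apply, Fin.sum_univ_two] at u00 u01 u10 u11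
  have hbc : b * star b = c * star c := by
    simp only [Complex.star_def]
    linear_combination hf₁ - u00
  have hda : d * star d = a * star a := by
    simp only [Complex.star_def]
    linear_combination hf₂ - u00
  obtain ⟨X₁, X₂, S, hS, h⟩ := aux_main (a * star a) (c * star c) (a * star b)
    (mul_star_self_nonneg a) (mul_star_self_nonneg c) (by simpa using u00)
    (by rw [← hbc, star_mul, star_star]; ring) σ₁ σ₂ hσ₁ hσ₂
  refine ⟨X₁, X₂, S, hS, ?_⟩
  rw [← h, hρ, kron2, kron2, fromBlocks_add]
  have v01 : c * star d = -(a * star b) := by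
    simp only [Complex.star_def]; linear_combination u01
  have v10 : d * star c = -(b * star a) := by
    simp only [Complex.star_def]; linear_combination u10
  simp only [proj2, vecMulVec_apply, Pi.star_apply, Matrix.cons_val_zero, Matrix.cons_val_one,
    star_mul, star_star, v01, v10, hbc, hda, neg_smul, sub_eq_add_neg]
end

section
/- Let N ≥ 1 and let X₁, X₂, S be N×N complex matrices with S normal (S†S = SS†). Set ρ = X†X where X = fromBlocks X₁ (S·X₁) 0 X₂, and write ρ = fromBlocks ρ₁₁ ρ₁₂ ρ₂₁ ρ₂₂ in N×N blocks. Then the partial transpose ρ^{T_A} = fromBlocks ρ₁₁ ρ₂₁ ρ₁₂ ρ₂₂ is positive semidefinite; in fact ρ^{T_A} = Y†Y with Y = fromBlocks X₁ (S†·X₁) 0 X₂. In particular, every SPPT state is PPT. -/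
open Matrix ComplexOrder

/-- The partial transpose (with respect to the first, 2-dimensional factor) of a
`2 × 2` block matrix with `N × N` blocks: the two off-diagonal blocks are swapped. -/
noncomputable def partialTransposeA {N : ℕ}
    (ρ : Matrix (Fin N ⊕ Fin N) (Fin N ⊕ Fin N) ℂ) :
    Matrix (Fin N ⊕ Fin N) (Fin N ⊕ Fin N) ℂ :=
  fromBlocks ρ.toBlocks₁₁ ρ.toBlocks₂₁ ρ.toBlocks₁₂ ρ.toBlocks₂₂

/-- Every SPPT `2 × N` state is PPT: if `ρ = XᴴX` with `X = fromBlocks X₁ (S·X₁) 0 X₂`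
and `S` normal, then the partial transpose of `ρ` equals `YᴴY` with
`Y = fromBlocks X₁ (Sᴴ·X₁) 0 X₂` and is in particular positive semidefinite. -/
theorem sppt_isPPT {N : ℕ} (hN : 1 ≤ N)
    (X₁ X₂ S : Matrix (Fin N) (Fin N) ℂ)
    (hS : Sᴴ * S = S * Sᴴ)
    (ρ : Matrix (Fin N ⊕ Fin N) (Fin N ⊕ Fin N) ℂ)
    (hρ : ρ = (fromBlocks X₁ (S * X₁) 0 X₂)ᴴ * fromBlocks X₁ (S * X₁) 0 X₂) :
    partialTransposeA ρ =
      (fromBlocks X₁ (Sᴴ * X₁) 0 X₂)ᴴ * fromBlocks X₁ (Sᴴ * X₁) 0 X₂ ∧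
    (partialTransposeA ρ).PosSemidef := by
  have h : partialTransposeA ρ =
      (fromBlocks X₁ (Sᴴ * X₁) 0 X₂)ᴴ * fromBlocks X₁ (Sᴴ * X₁) 0 X₂ := by
    have h2 : X₁ᴴ * Sᴴ * (S * X₁) = X₁ᴴ * S * (Sᴴ * X₁) := by
      rw [Matrix.mul_assoc, ← Matrix.mul_assoc Sᴴ, hS, Matrix.mul_assoc S, ← Matrix.mul_assoc]
    subst hρ
    simp [partialTransposeA, fromBlocks_conjTranspose, fromBlocks_multiply, h2,
      Matrix.conjTranspose_mul, Matrix.mul_assoc]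
  refine ⟨h, ?_⟩
  rw [h]
  exact Matrix.posSemidef_conjTranspose_mul_self _
end

section
/- Let M, N ≥ 1 and let ρ be an MN×MN complex matrix which is classical-quantum: there exist an orthonormal basis {f₁, …, f_M} of ℂ^M and positive semidefinite N×N matrices σ₁, …, σ_M such that ρ = Σ_k |f_k⟩⟨f_k| ⊗ σ_k. Let ρ_A be the M×M matrix with entries (ρ_A)_{ij} = Σ_k trace of the (i,j) N×N block of ρ (the partial trace of ρ over the second factor). Then ρ commutes with ρ_A ⊗ I_N: ρ · (ρ_A ⊗ I_N) = (ρ_A ⊗ I_N) · ρ. -/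
open Matrix Kronecker ComplexOrder

/-- The rank-one projector `|f⟩⟨f|` onto a vector `f ∈ ℂ^M`. -/
noncomputable def projM {M : ℕ} (f : Fin M → ℂ) : Matrix (Fin M) (Fin M) ℂ :=
  vecMulVec f (star f)

/-- The reduced state `ρ_A`: the `M × M` matrix whose `(i,j)` entry is the trace
of the `(i,j)` `N × N` block of `ρ` (partial trace over the second factor). -/
noncomputable def reducedA {M N : ℕ}
    (ρ : Matrix (Fin M × Fin N) (Fin M × Fin N) ℂ) : Matrix (Fin M) (Fin M) ℂ :=
  Matrix.of fun i j => ∑ n : Fin N, ρ (i, n) (j, n)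

/-- Every classical–quantum state `ρ = Σ_k |f_k⟩⟨f_k| ⊗ σ_k` commutes with
`ρ_A ⊗ I_N`. -/
theorem classicalQuantum_commutes_reducedA {M N : ℕ} (hM : 1 ≤ M) (hN : 1 ≤ N)
    (f : Fin M → Fin M → ℂ)
    (hf : ∀ i j, star (f i) ⬝ᵥ f j = if i = j then (1 : ℂ) else 0)
    (σ : Fin M → Matrix (Fin N) (Fin N) ℂ)
    (hσ : ∀ k, (σ k).PosSemidef)
    (ρ : Matrix (Fin M × Fin N) (Fin M × Fin N) ℂ)
    (hρ : ρ = ∑ k : Fin M, projM (f k) ⊗ₖ σ k) :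
    ρ * (reducedA ρ ⊗ₖ (1 : Matrix (Fin N) (Fin N) ℂ)) =
      (reducedA ρ ⊗ₖ (1 : Matrix (Fin N) (Fin N) ℂ)) * ρ := by
  have hA : reducedA ρ = ∑ k : Fin M, (σ k).trace • projM (f k) := by
    ext i j
    simp only [reducedA, hρ, Matrix.of_apply, Matrix.sum_apply, kroneckerMap_apply,
      Matrix.smul_apply, smul_eq_mul, Matrix.trace, Matrix.diag_apply]
    rw [Finset.sum_comm]
    refine Finset.sum_congr rfl fun k _ => ?_
    rw [← Finset.mul_sum, mul_comm]
  have hP : ∀ k l, Commute (projM (f k)) (projM (f l)) := by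
    intro k l
    by_cases h : k = l
    · subst h; exact Commute.refl _
    · have h' : l ≠ k := fun e => h e.symm
      simp only [Commute, SemiconjBy, projM, vecMulVec_mul_vecMulVec, hf, if_neg h, if_neg h',
        zero_smul]
      simp
  have hc : ∀ k, Commute (projM (f k)) (reducedA ρ) := by
    intro k
    rw [hA]
    exact Commute.sum_right _ _ _ fun l _ => (hP k l).smul_right _
  generalize reducedA ρ = A at hc
  subst hρ
  rw [Finset.sum_mul, Finset.mul_sum]
  refine Finset.sum_congr rfl fun k _ => ?_
  rw [← mul_kronecker_mul, ← mul_kronecker_mul, (hc k).eq, mul_one, one_mul]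
end

section
/- Let M, N ≥ 1 and let ρ be an MN×MN complex matrix which is simultaneously classical-quantum and quantum-classical: there exist an orthonormal basis {f₁, …, f_M} of ℂ^M and positive semidefinite N×N matrices σ₁, …, σ_M with ρ = Σ_k |f_k⟩⟨f_k| ⊗ σ_k, and an orthonormal basis {g₁, …, g_N} of ℂ^N and positive semidefinite M×M matrices τ₁, …, τ_N with ρ = Σ_α τ_α ⊗ |g_α⟩⟨g_α|. Then ρ is diagonal in a product basis: there exist nonnegative real numbers λ_{kα} such that ρ = Σ_{k,α} λ_{kα} |f_k⟩⟨f_k| ⊗ |g_α⟩⟨g_α|. -/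
open Matrix Kronecker ComplexOrder

/-- A state that is simultaneously classical–quantum and quantum–classical is
diagonal in a product basis: `ρ = Σ_{k,α} λ_{kα} |f_k⟩⟨f_k| ⊗ |g_α⟩⟨g_α|`
with `λ_{kα} ≥ 0`. -/
theorem classicalQuantum_and_quantumClassical_diagonal {M N : ℕ}
    (hM : 1 ≤ M) (hN : 1 ≤ N)
    (f : Fin M → Fin M → ℂ)
    (hf : ∀ i j, star (f i) ⬝ᵥ f j = if i = j then (1 : ℂ) else 0)
    (g : Fin N → Fin N → ℂ)
    (hg : ∀ i j, star (g i) ⬝ᵥ g j = if i = j then (1 : ℂ) else 0)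
    (σ : Fin M → Matrix (Fin N) (Fin N) ℂ) (hσ : ∀ k, (σ k).PosSemidef)
    (τ : Fin N → Matrix (Fin M) (Fin M) ℂ) (hτ : ∀ α, (τ α).PosSemidef)
    (ρ : Matrix (Fin M × Fin N) (Fin M × Fin N) ℂ)
    (hρA : ρ = ∑ k : Fin M, projM (f k) ⊗ₖ σ k)
    (hρB : ρ = ∑ α : Fin N, τ α ⊗ₖ projM (g α)) :
    ∃ lam : Fin M → Fin N → ℝ,
      (∀ k α, 0 ≤ lam k α) ∧
      ρ = ∑ k : Fin M, ∑ α : Fin N,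
            (lam k α : ℂ) • (projM (f k) ⊗ₖ projM (g α)) := by
  have hQQ : ∀ a b, projM (g a) * projM (g b) = if a = b then projM (g a) else 0 := by
    intro a b
    unfold projM
    rw [vecMulVec_mul_vecMulVec, hg]
    split_ifs with h
    · subst h; simp
    · simp
  have hQsQ : ∀ (S : Matrix (Fin N) (Fin N) ℂ) a, projM (g a) * S * projM (g a)
      = (star (g a) ⬝ᵥ (S *ᵥ g a)) • projM (g a) := by
    intro S a
    unfold projM
    rw [vecMulVec_mul, vecMulVec_mul_vecMulVec, ← dotProduct_mulVec, vecMulVec_smul]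
  have hnn : ∀ k a, 0 ≤ star (g a) ⬝ᵥ (σ k *ᵥ g a) := fun k a =>
    (hσ k).dotProduct_mulVec_nonneg (g a)
  have hre : ∀ k a, (((star (g a) ⬝ᵥ (σ k *ᵥ g a)).re : ℝ) : ℂ)
      = star (g a) ⬝ᵥ (σ k *ᵥ g a) := by
    intro k a
    have h := Complex.nonneg_iff.1 (hnn k a)
    exact Complex.ext (by simp) (by simp [← h.2])
  refine ⟨fun k a => (star (g a) ⬝ᵥ (σ k *ᵥ g a)).re,
    fun k a => (Complex.nonneg_iff.1 (hnn k a)).1, ?_⟩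
  have key : ρ = ∑ a : Fin N, ((1 : Matrix (Fin M) (Fin M) ℂ) ⊗ₖ projM (g a)) * ρ *
      ((1 : Matrix (Fin M) (Fin M) ℂ) ⊗ₖ projM (g a)) := by
    conv_lhs => rw [hρB]
    refine Finset.sum_congr rfl fun a _ => ?_
    rw [hρB, Finset.mul_sum, Finset.sum_mul, Finset.sum_eq_single a]
    · rw [← mul_kronecker_mul, ← mul_kronecker_mul]
      simp [hQQ]
    · intro b _ hb
      rw [← mul_kronecker_mul, hQQ, if_neg (Ne.symm hb)]
      simp
    · simp
  rw [key, Finset.sum_comm]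
  refine Finset.sum_congr rfl fun a _ => ?_
  rw [hρA, Finset.mul_sum, Finset.sum_mul]
  refine Finset.sum_congr rfl fun k _ => ?_
  rw [← mul_kronecker_mul, ← mul_kronecker_mul, hQsQ, hre]
  simp [kronecker_smul]
end

section
/- Let ρ be the 4×4 X-state determined by 2×2 matrices a = [[a₁₁, a₁₂],[conj(a₁₂), a₂₂]] and b = [[b₁₁, b₁₂],[conj(b₁₂), b₂₂]], with a₁₁, a₂₂, b₁₁, b₂₂ real, a₁₁ > 0, b₁₁ > 0, and assume ρ is positive semidefinite. Then ρ is SPPT — i.e. there exist 2×2 complex matrices X₁, X₂, S with S normal and ρ = X†X for X = fromBlocks X₁ (S·X₁) 0 X₂ — if and only if |a₁₂| = |b₁₂|. -/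
open Matrix ComplexOrder

/-- The two-qubit X-state determined by the `2 × 2` matrices `a` and `b`. -/
noncomputable def Xstate (a b : Matrix (Fin 2) (Fin 2) ℂ) :
    Matrix (Fin 2 ⊕ Fin 2) (Fin 2 ⊕ Fin 2) ℂ :=
  fromBlocks !![a 0 0, 0; 0, b 0 0] !![0, a 0 1; b 0 1, 0]
             !![0, b 1 0; a 1 0, 0] !![b 1 1, 0; 0, a 1 1]

/-- A `4 × 4` state, viewed as a `2 × 2` block matrix with `2 × 2` blocks, is SPPT
if `ρ = XᴴX` with `X = fromBlocks X₁ (S·X₁) 0 X₂` for some normal `S`. -/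
def IsSPPT (ρ : Matrix (Fin 2 ⊕ Fin 2) (Fin 2 ⊕ Fin 2) ℂ) : Prop :=
  ∃ X₁ X₂ S : Matrix (Fin 2) (Fin 2) ℂ,
    Sᴴ * S = S * Sᴴ ∧
    ρ = (fromBlocks X₁ (S * X₁) 0 X₂)ᴴ * fromBlocks X₁ (S * X₁) 0 X₂

/-- A positive semidefinite Hermitian X-state with `a₁₁ > 0` and `b₁₁ > 0` is SPPT
if and only if `|a₁₂| = |b₁₂|`. -/
theorem xstate_isSPPT_iff (a₁₁ a₂₂ b₁₁ b₂₂ : ℝ) (a₁₂ b₁₂ : ℂ)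
    (ha : 0 < a₁₁) (hb : 0 < b₁₁)
    (hρ : (Xstate !![(a₁₁ : ℂ), a₁₂; (starRingEnd ℂ) a₁₂, (a₂₂ : ℂ)]
                  !![(b₁₁ : ℂ), b₁₂; (starRingEnd ℂ) b₁₂, (b₂₂ : ℂ)]).PosSemidef) :
    IsSPPT (Xstate !![(a₁₁ : ℂ), a₁₂; (starRingEnd ℂ) a₁₂, (a₂₂ : ℂ)]
                   !![(b₁₁ : ℂ), b₁₂; (starRingEnd ℂ) b₁₂, (b₂₂ : ℂ)]) ↔
      ‖a₁₂‖ = ‖b₁₂‖ := by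
  have hA : (‖a₁₂‖ ^ 2 : ℝ) ≤ a₁₁ * a₂₂ := by
    have h := (hρ.submatrix ![Sum.inl 0, Sum.inr 1]).det_nonneg
    rw [det_fin_two] at h
    simp [Xstate, Complex.mul_conj, Complex.normSq_eq_norm_sq] at h
    exact_mod_cast h
  have hB : (‖b₁₂‖ ^ 2 : ℝ) ≤ b₁₁ * b₂₂ := by
    have h := (hρ.submatrix ![Sum.inl 1, Sum.inr 0]).det_nonneg
    rw [det_fin_two] at h
    simp [Xstate, Complex.mul_conj, Complex.normSq_eq_norm_sq] at h
    exact_mod_cast h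
  have ha' : (a₁₁ : ℂ) ≠ 0 := by exact_mod_cast ha.ne'
  have hb' : (b₁₁ : ℂ) ≠ 0 := by exact_mod_cast hb.ne'
  constructor
  · rintro ⟨X₁, X₂, S, hS, h⟩
    rw [Xstate, fromBlocks_conjTranspose, fromBlocks_multiply, fromBlocks_inj] at h
    obtain ⟨h1, h2, -, -⟩ := h
    simp at h1 h2
    set B : Matrix (Fin 2) (Fin 2) ℂ := !![0, a₁₂; b₁₂, 0] with hBdef
    set D : Matrix (Fin 2) (Fin 2) ℂ := !![(a₁₁ : ℂ)⁻¹, 0; 0, (b₁₁ : ℂ)⁻¹] with hD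
    have hX : X₁ * (D * X₁ᴴ) = 1 := by
      rw [mul_eq_one_comm, mul_assoc, ← h1, hD]
      ext i j; fin_cases i <;> fin_cases j <;> simp [ha', hb']
    have e1 : Bᴴ * D * B = X₁ᴴ * (Sᴴ * S) * X₁ := by
      rw [h2]
      calc _ = X₁ᴴ * Sᴴ * (X₁ * (D * X₁ᴴ)) * S * X₁ := by
            simp [conjTranspose_mul, Matrix.mul_assoc]
        _ = _ := by rw [hX]; simp [Matrix.mul_assoc]
    have e2 : B * D * Bᴴ = X₁ᴴ * (S * Sᴴ) * X₁ := by
      rw [h2]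
      calc _ = X₁ᴴ * S * (X₁ * (D * X₁ᴴ)) * Sᴴ * X₁ := by
            simp [conjTranspose_mul, Matrix.mul_assoc]
        _ = _ := by rw [hX]; simp [Matrix.mul_assoc]
    rw [hS, ← e2] at e1
    have e := congrFun (congrFun e1 0) 0
    simp [hBdef, hD, Matrix.mul_apply, Fin.sum_univ_two] at e
    have e3 : b₁₂ * (starRingEnd ℂ) b₁₂ = a₁₂ * (starRingEnd ℂ) a₁₂ := by
      field_simp at e
      linear_combination e
    rw [Complex.mul_conj, Complex.mul_conj, Complex.normSq_eq_norm_sq,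
      Complex.normSq_eq_norm_sq] at e3
    have e4 : ‖b₁₂‖ ^ 2 = ‖a₁₂‖ ^ 2 := by exact_mod_cast e3
    exact ((sq_eq_sq₀ (norm_nonneg _) (norm_nonneg _)).1 e4).symm
  · intro hn
    obtain ⟨p, hp, rfl⟩ : ∃ p : ℝ, 0 < p ∧ a₁₁ = p * p :=
      ⟨√a₁₁, Real.sqrt_pos.2 ha, (Real.mul_self_sqrt ha.le).symm⟩
    obtain ⟨q, hq, rfl⟩ : ∃ q : ℝ, 0 < q ∧ b₁₁ = q * q :=
      ⟨√b₁₁, Real.sqrt_pos.2 hb, (Real.mul_self_sqrt hb.le).symm⟩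
    have hp' : (p : ℂ) ≠ 0 := by exact_mod_cast hp.ne'
    have hq' : (q : ℂ) ≠ 0 := by exact_mod_cast hq.ne'
    obtain ⟨u, hu⟩ : ∃ u : ℝ, b₂₂ - ‖b₁₂‖ ^ 2 / (q * q) = u * u := by
      refine ⟨√(b₂₂ - ‖b₁₂‖ ^ 2 / (q * q)), (Real.mul_self_sqrt ?_).symm⟩
      rw [sub_nonneg, div_le_iff₀ hb]; linarith
    obtain ⟨v, hv⟩ : ∃ v : ℝ, a₂₂ - ‖a₁₂‖ ^ 2 / (p * p) = v * v := by
      refine ⟨√(a₂₂ - ‖a₁₂‖ ^ 2 / (p * p)), (Real.mul_self_sqrt ?_).symm⟩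
      rw [sub_nonneg, div_le_iff₀ ha]; linarith
    have ka : (starRingEnd ℂ) a₁₂ * a₁₂ = (‖a₁₂‖ : ℂ) ^ 2 := Complex.conj_mul' _
    have kb : (starRingEnd ℂ) b₁₂ * b₁₂ = (‖b₁₂‖ : ℂ) ^ 2 := Complex.conj_mul' _
    have kab : (starRingEnd ℂ) a₁₂ * a₁₂ = (starRingEnd ℂ) b₁₂ * b₁₂ := by rw [ka, kb, hn]
    have hu' : (b₂₂ : ℂ) - (starRingEnd ℂ) b₁₂ * b₁₂ / (q * q) = u * u := by
      rw [kb]; exact_mod_cast hu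
    have hv' : (a₂₂ : ℂ) - (starRingEnd ℂ) a₁₂ * a₁₂ / (p * p) = v * v := by
      rw [ka]; exact_mod_cast hv
    refine ⟨!![(p : ℂ), 0; 0, (q : ℂ)], !![(u : ℂ), 0; 0, (v : ℂ)],
      !![0, a₁₂ / (p * q); b₁₂ / (p * q), 0], ?_, ?_⟩
    · ext i j
      fin_cases i <;> fin_cases j <;> simp [Matrix.mul_apply, Fin.sum_univ_two] <;>
        field_simp <;> first | linear_combination kab | linear_combination -kab
    · rw [Xstate, fromBlocks_conjTranspose, fromBlocks_multiply, fromBlocks_inj]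
      refine ⟨?_, ?_, ?_, ?_⟩ <;> ext i j <;> fin_cases i <;> fin_cases j <;>
        simp [Matrix.mul_apply, Fin.sum_univ_two]
      · field_simp
      · field_simp
      · field_simp
      · field_simp
      · rw [← hu']; field_simp; ring
      · rw [← hv']; field_simp; ring
end

section
/- Let p₁, p₂, p₃, p₄ be nonnegative reals with p₁+p₂+p₃+p₄ = 1, p₁+p₂ > 0 and p₃+p₄ > 0, and let ρ be the Bell-diagonal two-qubit state, i.e. the X-state with a₁₁ = a₂₂ = p₁+p₂, a₁₂ = p₁−p₂, b₁₁ = b₂₂ = p₃+p₄, b₁₂ = p₃−p₄ (all real). Then ρ is SPPT — there exist 2×2 matrices X₁, X₂, S with S normal and ρ = X†X for X = fromBlocks X₁ (S·X₁) 0 X₂ — if and only if |p₁−p₂| = |p₃−p₄|. -/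
open Matrix ComplexOrder

/-- A Bell-diagonal two-qubit state is SPPT iff `|p₁ − p₂| = |p₃ − p₄|`. -/
theorem bellDiagonal_isSPPT_iff (p₁ p₂ p₃ p₄ : ℝ)
    (h₁ : 0 ≤ p₁) (h₂ : 0 ≤ p₂) (h₃ : 0 ≤ p₃) (h₄ : 0 ≤ p₄)
    (hsum : p₁ + p₂ + p₃ + p₄ = 1)
    (ha : 0 < p₁ + p₂) (hb : 0 < p₃ + p₄) :
    IsSPPT (Xstate !![((p₁ + p₂ : ℝ) : ℂ), ((p₁ - p₂ : ℝ) : ℂ);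
                      ((p₁ - p₂ : ℝ) : ℂ), ((p₁ + p₂ : ℝ) : ℂ)]
                   !![((p₃ + p₄ : ℝ) : ℂ), ((p₃ - p₄ : ℝ) : ℂ);
                      ((p₃ - p₄ : ℝ) : ℂ), ((p₃ + p₄ : ℝ) : ℂ)]) ↔
      |p₁ - p₂| = |p₃ - p₄| := by
  have hac : (p₁ - p₂)^2 ≤ (p₁ + p₂)^2 := by nlinarith [mul_nonneg h₁ h₂]
  have hbd : (p₃ - p₄)^2 ≤ (p₃ + p₄)^2 := by nlinarith [mul_nonneg h₃ h₄]
  rw [← sq_eq_sq_iff_abs_eq_abs]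
  generalize p₁ + p₂ = a at *
  generalize p₁ - p₂ = c at *
  generalize p₃ + p₄ = b at *
  generalize p₃ - p₄ = d at *
  have ha' : (a : ℂ) ≠ 0 := by exact_mod_cast ha.ne'
  have hb' : (b : ℂ) ≠ 0 := by exact_mod_cast hb.ne'
  constructor
  · rintro ⟨X, Y, S, hS, h⟩
    rw [Xstate, fromBlocks_conjTranspose, fromBlocks_multiply, fromBlocks_inj] at h
    obtain ⟨hA, hB, hC, -⟩ := h
    simp only [conjTranspose_zero, zero_mul, mul_zero, add_zero, zero_add, conjTranspose_mul] at hA hB hC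
    set M : Matrix (Fin 2) (Fin 2) ℂ := !![(a : ℂ)⁻¹, 0; 0, (b : ℂ)⁻¹] with hM
    have h1 : Xᴴ * (X * M) = 1 := by
      rw [← mul_assoc, ← hA, hM]
      ext i j
      fin_cases i <;> fin_cases j <;> simp [ha', hb']
    have h2 : X * M * Xᴴ = 1 := mul_eq_one_comm.mp h1
    have e1 : (Xᴴ * (S * X)) * M * (Xᴴ * Sᴴ * X) = Xᴴ * (S * Sᴴ) * X := by
      calc _ = Xᴴ * S * (X * M * Xᴴ) * Sᴴ * X := by simp only [mul_assoc]
        _ = _ := by rw [h2]; simp only [mul_assoc, mul_one, one_mul]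
    have e2 : (Xᴴ * Sᴴ * X) * M * (Xᴴ * (S * X)) = Xᴴ * (Sᴴ * S) * X := by
      calc _ = Xᴴ * Sᴴ * (X * M * Xᴴ) * S * X := by simp only [mul_assoc]
        _ = _ := by rw [h2]; simp only [mul_assoc, mul_one, one_mul]
    rw [hS, ← e1, ← hB, ← hC, hM] at e2
    have e3 := congrFun (congrFun e2 0) 0
    simp [Matrix.mul_apply, Fin.sum_univ_two] at e3
    field_simp at e3
    have e4 : d ^ 2 = c ^ 2 := by exact_mod_cast e3
    exact e4.symm
  · intro h
    have key : ∀ x : ℝ, 0 ≤ x → ((√x : ℝ) : ℂ) * ((√x : ℝ) : ℂ) = (x : ℂ) := by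
      intro x hx
      exact_mod_cast Real.mul_self_sqrt hx
    have hx : 0 ≤ b - d ^ 2 / b := by
      rw [sub_nonneg, div_le_iff₀ hb]; nlinarith
    have hy : 0 ≤ a - c ^ 2 / a := by
      rw [sub_nonneg, div_le_iff₀ ha]; nlinarith
    have ka := key a ha.le
    have kb := key b hb.le
    have kx := key _ hx
    have ky := key _ hy
    have ra : ((√a : ℝ) : ℂ) ≠ 0 := by exact_mod_cast (Real.sqrt_pos.2 ha).ne'
    have rb : ((√b : ℝ) : ℂ) ≠ 0 := by exact_mod_cast (Real.sqrt_pos.2 hb).ne'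
    have hc : (c : ℂ) ^ 2 = (d : ℂ) ^ 2 := by exact_mod_cast h
    push_cast at kx ky
    refine ⟨!![((√a : ℝ) : ℂ), 0; 0, ((√b : ℝ) : ℂ)],
      !![((√(b - d ^ 2 / b) : ℝ) : ℂ), 0; 0, ((√(a - c ^ 2 / a) : ℝ) : ℂ)],
      !![0, (c : ℂ) / (((√a : ℝ) : ℂ) * ((√b : ℝ) : ℂ));
         (d : ℂ) / (((√a : ℝ) : ℂ) * ((√b : ℝ) : ℂ)), 0], ?_, ?_⟩
    · ext i j
      fin_cases i <;> fin_cases j <;> simp [Matrix.mul_apply, Fin.sum_univ_two] <;>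
        field_simp <;> simp [hc]
    · rw [Xstate, fromBlocks_conjTranspose, fromBlocks_multiply, fromBlocks_inj]
      refine ⟨?_, ?_, ?_, ?_⟩ <;> ext i j <;>
      fin_cases i <;> fin_cases j <;> simp [Matrix.mul_apply, Fin.sum_univ_two, ka, kb, kx, ky]
      all_goals try rw [← ka]
      all_goals try rw [← kb]
      all_goals field_simp
      all_goals ring
end
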